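/- arXiv:math/0011041 — 4 statements merged into one kernel-verified Lean document; each statement's English description precedes it below -/
import Mathlib

section
/- Let n ≥ 1, let E = EuclideanSpace ℝ (Fin n), let U, V ⊆ E be open and convex, let K : E → ℝ be convex and differentiable on U with gradient map ∇K, and let g : E → E be differentiable on V with g(V) ⊆ U and ∇K(g(y)) = y for all y ∈ V. Suppose that at every x ∈ U the gradient map ∇K is differentiable with Fréchet derivative H(x), and that K satisfies the real Monge–Ampère equation: det H(x) = c for all x ∈ U, where c is a constant. Define the Legendre transform K̂(y) = sup_{x ∈ U} (⟪x, y⟫ − K(x)). Then for every y ∈ V: K̂ is differentiable at y with gradient g(y), the gradient map of K̂ is differentiable at y with derivative Ĥ(y), and det Ĥ(y) = c⁻¹. In particular the Legendre transform K̂ also satisfies the Monge–Ampère equation, with constant Hessian determinant c⁻¹. (This is the paper's Lemma 1.) -/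
open scoped RealInnerProductSpace

/-- The tangent plane inequality: a convex function lies above its linearization at a point. -/
theorem ConvexOn.add_fderiv_sub_le {E : Type*} [NormedAddCommGroup E] [NormedSpace ℝ E]
    {s : Set E} {f : E → ℝ} {f' : E →L[ℝ] ℝ} {x z : E} (hf : ConvexOn ℝ s f)
    (hx : x ∈ s) (hz : z ∈ s) (hf' : HasFDerivAt f f' x) : f x + f' (z - x) ≤ f z := by
  have hderiv : HasDerivAt (f ∘ AffineMap.lineMap (k := ℝ) x z) (f' (z - x)) 0 :=
    HasFDerivAt.comp_hasDerivAt (0 : ℝ) (by simpa using hf') AffineMap.hasDerivAt_lineMap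
  have h := (hf.comp_affineMap (AffineMap.lineMap (k := ℝ) x z)).le_slope_of_hasDerivAt
    (x := 0) (y := 1) (by simpa using hx) (by simpa using hz) one_pos hderiv
  simp only [slope_def_field, Function.comp_apply, AffineMap.lineMap_apply_zero,
    AffineMap.lineMap_apply_one, sub_zero, div_one] at h
  linarith

/-- The supremum defining the Legendre transform at `∇K x` is attained at `x`. -/
theorem ConvexOn.isGreatest_inner_sub {E : Type*} [NormedAddCommGroup E]
    [InnerProductSpace ℝ E] [CompleteSpace E] {s : Set E} {K : E → ℝ} {x y : E}
    (hK : ConvexOn ℝ s K) (hx : x ∈ s) (hgrad : HasGradientAt K y x) :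
    IsGreatest ((fun z => ⟪z, y⟫ - K z) '' s) (⟪x, y⟫ - K x) := by
  refine ⟨⟨x, hx, rfl⟩, ?_⟩
  rintro _ ⟨z, hz, rfl⟩
  have h := hK.add_fderiv_sub_le hx hz hgrad.hasFDerivAt
  rw [InnerProductSpace.toDual_apply_apply, inner_sub_right, real_inner_comm,
    real_inner_comm x] at h
  linarith

/-- The function `y ↦ ⟪g y, y⟫ - K (g y)` has gradient `g y` wherever `∇K (g y) = y`. -/
theorem HasGradientAt.inner_sub_comp {E : Type*} [NormedAddCommGroup E]
    [InnerProductSpace ℝ E] [CompleteSpace E] {K : E → ℝ} {g : E → E} {y : E}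
    (hK : HasGradientAt K y (g y)) (hg : DifferentiableAt ℝ g y) :
    HasGradientAt (fun z => ⟪g z, z⟫ - K (g z)) (g y) y := by
  rw [hasGradientAt_iff_hasFDerivAt]
  have hcomp := hK.hasFDerivAt.comp y hg.hasFDerivAt
  refine ((hg.hasFDerivAt.inner ℝ (hasFDerivAt_id y)).sub hcomp).congr_fderiv ?_
  ext v
  simp [fderivInnerCLM_apply, real_inner_comm]

/-- The derivative of a local right inverse has inverse determinant. -/
theorem HasFDerivAt.det_eq_inv_of_rightInverse {𝕜 E : Type*} [NontriviallyNormedField 𝕜]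
    [NormedAddCommGroup E] [NormedSpace 𝕜 E] {f g : E → E} {f' g' : E →L[𝕜] E} {y : E}
    (hf : HasFDerivAt f f' (g y)) (hg : HasFDerivAt g g' y)
    (hfg : ∀ᶠ z in nhds y, f (g z) = z) :
    LinearMap.det (g' : E →ₗ[𝕜] E) = (LinearMap.det (f' : E →ₗ[𝕜] E))⁻¹ := by
  have hid : f'.comp g' = ContinuousLinearMap.id 𝕜 E :=
    (hf.comp y hg).unique ((hasFDerivAt_id y).congr_of_eventuallyEq hfg)
  refine eq_inv_of_mul_eq_one_right ?_
  rw [← LinearMap.det_comp, ← ContinuousLinearMap.toLinearMap_comp, hid]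
  simp

/-- the paper's Lemma 1: Let `K` be convex and differentiable on an open convex
set `U ⊆ ℝⁿ` with gradient map `∇K`, let `g` be differentiable on an open convex set `V` with
`g(V) ⊆ U` and `∇K (g y) = y` on `V`, and suppose the gradient map `∇K` is differentiable at
every `x ∈ U` with derivative `H x` (the Hessian) satisfying the real Monge–Ampère equation
`det (H x) = c`.  Then for every `y ∈ V` the Legendre transform
`K̂(y) = sup_{x ∈ U} (⟪x, y⟫ − K x)` has gradient `g y` at `y`, its gradient map `g` is
differentiable at `y` with derivative `Hhat`, and `det Hhat = c⁻¹`: the Legendre transform again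
satisfies the Monge–Ampère equation, with constant `c⁻¹`. -/
theorem legendre_transform_satisfies_mongeAmpere
    (n : ℕ) (hn : 1 ≤ n)
    (U V : Set (EuclideanSpace ℝ (Fin n)))
    (hUopen : IsOpen U) (hVopen : IsOpen V) (hUconv : Convex ℝ U) (hVconv : Convex ℝ V)
    (K : EuclideanSpace ℝ (Fin n) → ℝ) (hKconv : ConvexOn ℝ U K)
    (gradK : EuclideanSpace ℝ (Fin n) → EuclideanSpace ℝ (Fin n))
    (hK : ∀ x ∈ U, HasGradientAt K (gradK x) x)
    (g : EuclideanSpace ℝ (Fin n) → EuclideanSpace ℝ (Fin n))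
    (hgdiff : ∀ y ∈ V, DifferentiableAt ℝ g y)
    (hgU : Set.MapsTo g V U)
    (hinv : ∀ y ∈ V, gradK (g y) = y)
    (H : EuclideanSpace ℝ (Fin n) → EuclideanSpace ℝ (Fin n) →L[ℝ] EuclideanSpace ℝ (Fin n))
    (hH : ∀ x ∈ U, HasFDerivAt gradK (H x) x)
    (c : ℝ)
    (hMA : ∀ x ∈ U,
      LinearMap.det ((H x : EuclideanSpace ℝ (Fin n) →ₗ[ℝ] EuclideanSpace ℝ (Fin n))) = c) :
    ∀ y ∈ V,
      HasGradientAt (fun y' => sSup ((fun x => ⟪x, y'⟫ - K x) '' U)) (g y) y ∧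
      ∃ Hhat : EuclideanSpace ℝ (Fin n) →L[ℝ] EuclideanSpace ℝ (Fin n),
        HasFDerivAt g Hhat y ∧
        LinearMap.det ((Hhat : EuclideanSpace ℝ (Fin n) →ₗ[ℝ] EuclideanSpace ℝ (Fin n))) = c⁻¹ := by
  intro y hy
  have hgrad : ∀ z ∈ V, HasGradientAt K z (g z) := fun z hz => by
    simpa only [hinv z hz] using hK (g z) (hgU hz)
  have hVnhds : V ∈ nhds y := hVopen.mem_nhds hy
  refine ⟨((hgrad y hy).inner_sub_comp (hgdiff y hy)).congr_of_eventuallyEq ?_,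
    fderiv ℝ g y, (hgdiff y hy).hasFDerivAt, ?_⟩
  · filter_upwards [hVnhds] with z hz
    exact (hKconv.isGreatest_inner_sub (hgU hz) (hgrad z hz)).csSup_eq
  · rw [← hMA (g y) (hgU hy)]
    exact (hH (g y) (hgU hy)).det_eq_inv_of_rightInverse (hgdiff y hy).hasFDerivAt
      (Filter.eventually_of_mem hVnhds hinv)
end

section
/- Let n ≥ 1, let E = EuclideanSpace ℝ (Fin n), let U, V ⊆ E be open, let K : E → ℝ be twice continuously differentiable on a neighborhood of x₀ ∈ U, with gradient map ∇K, and let g : E → E be differentiable on V with g(V) ⊆ U and ∇K(g(y)) = y for all y ∈ V. Fix y₀ ∈ V with g(y₀) = x₀, let H be the Hessian of K at x₀ (the Fréchet derivative of ∇K at x₀) and let Ĥ be the Fréchet derivative of g at y₀ (the Hessian at y₀ of the Legendre transform K̂(y) = ⟪g(y), y⟫ − K(g(y)), whose gradient map on V is g). Then for all u, v ∈ E: ⟪Ĥ(H u), H v⟫ = ⟪H u, v⟫. That is, the differential H of the gradient map ∇K at x₀ is an isometry from the Hessian inner product (u, v) ↦ ⟪H u, v⟫ of K at x₀ to the Hessian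 inner product (u', v') ↦ ⟪Ĥ u', v'⟫ of K̂ at y₀. (This is the local content of the paper's Proposition 2: a Monge–Ampère manifold and its Legendre-dual have the same Riemannian metric.) -/
open scoped RealInnerProductSpace

/-- The Fréchet derivative of a gradient map is a symmetric operator. -/
theorem inner_hasFDerivAt_gradient_symm {E : Type*} [NormedAddCommGroup E]
    [InnerProductSpace ℝ E] [CompleteSpace E] {K : E → ℝ} {gradK : E → E} {x : E} {H : E →L[ℝ] E}
    (hK : ∀ᶠ y in nhds x, HasGradientAt K (gradK y) y) (hH : HasFDerivAt gradK H x) (u v : E) :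
    ⟪H u, v⟫ = ⟪u, H v⟫ := by
  have hdual : HasFDerivAt (fun y => innerSL ℝ (gradK y)) ((innerSL ℝ).comp H) x :=
    (innerSL ℝ : E →L[ℝ] E →L[ℝ] ℝ).hasFDerivAt.comp x hH
  have hsymm := second_derivative_symmetric_of_eventually
    (hK.mono fun y hy => hy.hasFDerivAt) hdual u v
  rw [real_inner_comm (H v) u]
  simpa using hsymm

/-- In finite dimension, the derivative of a local right inverse `g` of `f` is a left inverse of
the derivative of `f`. -/
theorem HasFDerivAt.comp_eq_id_of_rightInverse {E : Type*} [NormedAddCommGroup E]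
    [NormedSpace ℝ E] [FiniteDimensional ℝ E] {f g : E → E} {f' g' : E →L[ℝ] E} {y : E}
    (hf : HasFDerivAt f f' (g y)) (hg : HasFDerivAt g g' y) (hfg : ∀ᶠ z in nhds y, f (g z) = z) :
    g'.comp f' = ContinuousLinearMap.id ℝ E := by
  have hright : f'.comp g' = ContinuousLinearMap.id ℝ E :=
    (hf.comp y hg).unique ((hasFDerivAt_id y).congr_of_eventuallyEq hfg)
  have hleft : (g' : E →ₗ[ℝ] E) * (f' : E →ₗ[ℝ] E) = 1 :=
    mul_eq_one_comm.mp (LinearMap.ext fun w => DFunLike.congr_fun hright w)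
  exact ContinuousLinearMap.ext fun w => DFunLike.congr_fun hleft w

/-- local content of the paper's Proposition 2: with `K` twice continuously
differentiable near `x₀ = g y₀`, gradient map `∇K` satisfying `∇K ∘ g = id` on `V`,
`H` the Hessian of `K` at `x₀` (the Fréchet derivative of `∇K` at `x₀`) and `Hhat` the
derivative of `g` at `y₀` (the Hessian of the Legendre transform `K̂` at `y₀`), the map `H`
is an isometry from the Hessian inner product of `K` at `x₀` to the Hessian inner product of
`K̂` at `y₀`: `⟪Hhat (H u), H v⟫ = ⟪H u, v⟫` for all `u, v`. -/
theorem hessian_metric_isometry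
    (n : ℕ) (hn : 1 ≤ n)
    (U V : Set (EuclideanSpace ℝ (Fin n))) (hUopen : IsOpen U) (hVopen : IsOpen V)
    (x₀ : EuclideanSpace ℝ (Fin n)) (hx₀U : x₀ ∈ U)
    (K : EuclideanSpace ℝ (Fin n) → ℝ)
    (hC2 : ∃ W : Set (EuclideanSpace ℝ (Fin n)), IsOpen W ∧ x₀ ∈ W ∧ ContDiffOn ℝ 2 K W)
    (gradK : EuclideanSpace ℝ (Fin n) → EuclideanSpace ℝ (Fin n))
    (hK : ∀ x ∈ U, HasGradientAt K (gradK x) x)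
    (g : EuclideanSpace ℝ (Fin n) → EuclideanSpace ℝ (Fin n))
    (hgdiff : ∀ y ∈ V, DifferentiableAt ℝ g y)
    (hgU : Set.MapsTo g V U)
    (hinv : ∀ y ∈ V, gradK (g y) = y)
    (y₀ : EuclideanSpace ℝ (Fin n)) (hy₀ : y₀ ∈ V) (hgy₀ : g y₀ = x₀)
    (H Hhat : EuclideanSpace ℝ (Fin n) →L[ℝ] EuclideanSpace ℝ (Fin n))
    (hH : HasFDerivAt gradK H x₀) (hHhat : HasFDerivAt g Hhat y₀) :
    ∀ u v : EuclideanSpace ℝ (Fin n), ⟪Hhat (H u), H v⟫ = ⟪H u, v⟫ := by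
  intro u v
  subst hgy₀
  have hleft := hH.comp_eq_id_of_rightInverse hHhat
    (Filter.eventually_of_mem (hVopen.mem_nhds hy₀) hinv)
  have hu : Hhat (H u) = u := DFunLike.congr_fun hleft u
  rw [hu]
  exact (inner_hasFDerivAt_gradient_symm
    (Filter.eventually_of_mem (hUopen.mem_nhds hx₀U) hK) hH u v).symm
end

section
/- Let S be the set of Hahn series f ∈ HahnSeries ℝ ℂ whose support has finite intersection with every half-line (−∞, r], r ∈ ℝ (equivalently, the exponents occurring in f form a finite set or a strictly increasing sequence tending to +∞). Then S is a subfield of the field HahnSeries ℝ ℂ: it contains 0 and 1 and is closed under addition, negation, multiplication, and multiplicative inverses (if f ∈ S and f ≠ 0 then f⁻¹ ∈ S). In particular S is a field. -/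
namespace HahnSeries

/-- A Hahn series is finite below if only finitely many of its exponents lie below any bound. -/
def FiniteBelow {Γ R : Type*} [PartialOrder Γ] [Zero R] (f : HahnSeries Γ R) : Prop :=
  ∀ r : Γ, (f.support ∩ Set.Iic r).Finite

namespace FiniteBelow

theorem of_finite_support {Γ R : Type*} [PartialOrder Γ] [Zero R] {f : HahnSeries Γ R}
    (hf : f.support.Finite) : f.FiniteBelow :=
  fun _ => hf.subset Set.inter_subset_left

theorem zero {Γ R : Type*} [PartialOrder Γ] [Zero R] : (0 : HahnSeries Γ R).FiniteBelow :=
  of_finite_support (by simp)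

theorem single {Γ R : Type*} [PartialOrder Γ] [Zero R] (a : Γ) (c : R) :
    (HahnSeries.single a c).FiniteBelow :=
  of_finite_support ((Set.finite_singleton a).subset support_single_subset)

theorem one {Γ R : Type*} [PartialOrder Γ] [Zero Γ] [MulZeroOneClass R] : (1 : HahnSeries Γ R).FiniteBelow :=
  single 0 1

theorem add {Γ R : Type*} [PartialOrder Γ] [AddMonoid R] {f g : HahnSeries Γ R}
    (hf : f.FiniteBelow) (hg : g.FiniteBelow) : (f + g).FiniteBelow := fun r => by
  refine ((hf r).union (hg r)).subset ?_
  rw [← Set.union_inter_distrib_right]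
  exact Set.inter_subset_inter_left _ (support_add_subset f g)

theorem neg {Γ R : Type*} [PartialOrder Γ] [AddGroup R] {f : HahnSeries Γ R}
    (hf : f.FiniteBelow) : (-f).FiniteBelow := fun r => by
  rw [support_neg]
  exact hf r

variable {Γ R : Type*} [AddCommGroup Γ] [LinearOrder Γ] [IsOrderedAddMonoid Γ]

open scoped Pointwise in
theorem mul [NonUnitalNonAssocSemiring R] {f g : HahnSeries Γ R}
    (hf : f.FiniteBelow) (hg : g.FiniteBelow) : (f * g).FiniteBelow := fun r => by
  refine ((hf (r - g.order)).add (hg (r - f.order))).subset ?_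
  rintro _ ⟨ht, htr⟩
  obtain ⟨i, hi, j, hj, rfl⟩ := support_mul_subset ht
  have hfi : f.order ≤ i := order_le_of_coeff_ne_zero hi
  have hgj : g.order ≤ j := order_le_of_coeff_ne_zero hj
  have htr' : i + j ≤ r := htr
  exact ⟨i, ⟨hi, le_sub_iff_add_le.2 ((add_le_add_right hgj i).trans htr')⟩, j,
    ⟨hj, le_sub_iff_add_le'.2 ((add_le_add_left hfi j).trans htr')⟩, rfl⟩

open scoped Pointwise in
/-- If `x` has positive exponents and `h = 1 + x * h`, then `h` inherits finiteness from `x`. -/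
theorem of_eq_one_add_mul [Archimedean Γ] [NonAssocSemiring R] {x h : HahnSeries Γ R}
    (hx : x.FiniteBelow) (hpos : 0 < x.orderTop) (heq : h = 1 + x * h) : h.FiniteBelow := by
  rcases eq_or_ne x 0 with rfl | hx0
  · rw [heq, zero_mul, add_zero]
    exact one
  have hε : 0 < x.order := (zero_lt_orderTop_iff hx0).1 hpos
  have key : ∀ (n : ℕ) (r : Γ), r < h.order + n • x.order → (h.support ∩ Set.Iic r).Finite := by
    intro n
    induction n with
    | zero =>
      intro r hr
      refine Set.finite_empty.subset fun t ⟨ht, htr⟩ => ?_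
      have : h.order ≤ t := order_le_of_coeff_ne_zero ht
      have htr' : t ≤ r := htr
      simp only [zero_smul, add_zero] at hr
      exact absurd (this.trans htr') hr.not_ge
    | succ n ih =>
      intro r hr
      have hr' : r - x.order < h.order + n • x.order := by
        rw [sub_lt_iff_lt_add, add_assoc, ← succ_nsmul]
        exact hr
      refine ((one (R := R) r).union ((hx (r - h.order)).add (ih _ hr'))).subset ?_
      rintro t ⟨ht, htr⟩
      rw [heq] at ht
      rcases support_add_subset _ _ ht with h1 | hm
      · exact Or.inl ⟨h1, htr⟩
      obtain ⟨i, hi, j, hj, rfl⟩ := support_mul_subset hm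
      have hxi : x.order ≤ i := order_le_of_coeff_ne_zero hi
      have hhj : h.order ≤ j := order_le_of_coeff_ne_zero hj
      have htr' : i + j ≤ r := htr
      exact Or.inr ⟨i, ⟨hi, le_sub_iff_add_le.2 ((add_le_add_right hhj i).trans htr')⟩, j,
        ⟨hj, le_sub_iff_add_le'.2 ((add_le_add_left hxi j).trans htr')⟩, rfl⟩
  intro r
  obtain ⟨n, hn⟩ := exists_lt_nsmul hε (r - h.order)
  exact key n r (sub_lt_iff_lt_add'.1 hn)

theorem inv [Archimedean Γ] [Field R] {f : HahnSeries Γ R} (hf : f.FiniteBelow) :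
    f⁻¹.FiniteBelow := by
  rcases eq_or_ne f 0 with rfl | hf0
  · rw [inv_zero]
    exact zero
  have hc : f.leadingCoeff ≠ 0 := leadingCoeff_ne_zero.2 hf0
  set u := HahnSeries.single (-f.order) f.leadingCoeff⁻¹
  have hu0 : u ≠ 0 := single_ne_zero (inv_ne_zero hc)
  have hx : (1 - u * f).FiniteBelow := by
    rw [sub_eq_add_neg]
    exact one.add ((single _ _).mul hf).neg
  have hpos : 0 < (1 - u * f).orderTop :=
    unit_aux f (inv_mul_cancel₀ hc) _ (neg_add_cancel _)
  have hinv : f⁻¹ = u * (u * f)⁻¹ := by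
    field_simp
  rw [hinv]
  refine (single _ _).mul (of_eq_one_add_mul hx hpos ?_)
  field_simp
  ring

end FiniteBelow

end HahnSeries

/-- The set `S` of Hahn series over `ℂ` with real exponents whose support meets
every half-line `(−∞, r]` in a finite set (the paper's field
`ℂ_ε = {Σ aᵢ e^{−λᵢ/ε} : λᵢ → +∞}`) is a subfield of `HahnSeries ℝ ℂ`: it contains `0`
and `1`, and is closed under addition, negation, multiplication and inverses of nonzero
elements. -/
theorem hahnSeries_finite_below_support_is_subfield :
    (0 : HahnSeries ℝ ℂ) ∈ {f : HahnSeries ℝ ℂ | ∀ r : ℝ, (f.support ∩ Set.Iic r).Finite} ∧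
    (1 : HahnSeries ℝ ℂ) ∈ {f : HahnSeries ℝ ℂ | ∀ r : ℝ, (f.support ∩ Set.Iic r).Finite} ∧
    (∀ f g : HahnSeries ℝ ℂ,
      f ∈ {f : HahnSeries ℝ ℂ | ∀ r : ℝ, (f.support ∩ Set.Iic r).Finite} →
      g ∈ {f : HahnSeries ℝ ℂ | ∀ r : ℝ, (f.support ∩ Set.Iic r).Finite} →
      f + g ∈ {f : HahnSeries ℝ ℂ | ∀ r : ℝ, (f.support ∩ Set.Iic r).Finite}) ∧
    (∀ f : HahnSeries ℝ ℂ,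
      f ∈ {f : HahnSeries ℝ ℂ | ∀ r : ℝ, (f.support ∩ Set.Iic r).Finite} →
      -f ∈ {f : HahnSeries ℝ ℂ | ∀ r : ℝ, (f.support ∩ Set.Iic r).Finite}) ∧
    (∀ f g : HahnSeries ℝ ℂ,
      f ∈ {f : HahnSeries ℝ ℂ | ∀ r : ℝ, (f.support ∩ Set.Iic r).Finite} →
      g ∈ {f : HahnSeries ℝ ℂ | ∀ r : ℝ, (f.support ∩ Set.Iic r).Finite} →
      f * g ∈ {f : HahnSeries ℝ ℂ | ∀ r : ℝ, (f.support ∩ Set.Iic r).Finite}) ∧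
    (∀ f : HahnSeries ℝ ℂ,
      f ∈ {f : HahnSeries ℝ ℂ | ∀ r : ℝ, (f.support ∩ Set.Iic r).Finite} → f ≠ 0 →
      f⁻¹ ∈ {f : HahnSeries ℝ ℂ | ∀ r : ℝ, (f.support ∩ Set.Iic r).Finite}) := by
  exact ⟨HahnSeries.FiniteBelow.zero, HahnSeries.FiniteBelow.one,
    fun _ _ => HahnSeries.FiniteBelow.add, fun _ => HahnSeries.FiniteBelow.neg,
    fun _ _ => HahnSeries.FiniteBelow.mul, fun _ hf _ => HahnSeries.FiniteBelow.inv hf⟩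
end

section
/- Fix ε > 0 and n ≥ 1, and let f : ℝⁿ → ℝ be twice continuously differentiable. For y ∈ ℝⁿ let H(y) denote the second derivative of f at y (a symmetric bilinear form, by Schwarz's theorem). Define the ℂ-valued alternating 2-form F_y on the tangent space ℝⁿ × ℝⁿ by F_y((u, u'), (v, v')) = (2πi/ε) (H(y)(u, v') − H(y)(v, u')); this is the exterior derivative dA of the connection 1-form A_{(y,x)}(v, v') = (2πi/ε) ⟪∇f(y), v'⟫, i.e. F_p(w₁, w₂) = (DA(p) w₁)(w₂) − (DA(p) w₂)(w₁). Let J : ℝⁿ × ℝⁿ → ℝⁿ × ℝⁿ be the complex structure J(u, u') = (−u', u) (multiplication by i for the coordinates z_j = y_j + i x_j). Then for all w₁, w₂ ∈ ℝⁿ × ℝⁿ: F_y(w₁, w₂) − F_y(J w₁, J w₂) + i · (F_y(J w₁, w₂) + F_y(w₁, J w₂)) = 0. In other words, the (0,2)-part of the curvature of the connection ∇_E = d + (2πi/ε) Σ_j (∂f/∂y_j) dx_j vanishes, so ∇_E is a holomorphic connection (the paper's Proposition 12). -/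
open scoped RealInnerProductSpace

/-- the paper's Proposition 12: let `f : ℝⁿ → ℝ` be `C²` with Hessian
`H y u v = D²f(y)(u, v)`, let `F_y` be the curvature 2-form
`F_y((u,u'),(v,v')) = (2πi/ε)(H y u v' − H y v u')` of the connection
`∇_E = d + (2πi/ε) Σ_j (∂f/∂y_j) dx_j`, and let `J(u, u') = (−u', u)` be the complex
structure for the coordinates `z_j = y_j + i x_j`.  Then the `(0,2)`-part of `F` vanishes:
`F(w₁,w₂) − F(Jw₁,Jw₂) + i(F(Jw₁,w₂) + F(w₁,Jw₂)) = 0`, i.e. `∇_E` is a holomorphic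
connection. -/
theorem curvature_zero_two_part_vanishes
    (n : ℕ) (hn : 1 ≤ n) (ε : ℝ) (hε : 0 < ε)
    (f : EuclideanSpace ℝ (Fin n) → ℝ) (hf : ContDiff ℝ 2 f)
    (H : EuclideanSpace ℝ (Fin n) → EuclideanSpace ℝ (Fin n) → EuclideanSpace ℝ (Fin n) → ℝ)
    (hH : ∀ y u v, H y u v = (fderiv ℝ (fderiv ℝ f) y u) v)
    (F : EuclideanSpace ℝ (Fin n) →
      (EuclideanSpace ℝ (Fin n) × EuclideanSpace ℝ (Fin n)) →
      (EuclideanSpace ℝ (Fin n) × EuclideanSpace ℝ (Fin n)) → ℂ)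
    (hF : ∀ y w₁ w₂, F y w₁ w₂ =
      (2 * Real.pi * Complex.I / ε) * ((H y w₁.1 w₂.2 - H y w₂.1 w₁.2 : ℝ) : ℂ))
    (J : EuclideanSpace ℝ (Fin n) × EuclideanSpace ℝ (Fin n) →
      EuclideanSpace ℝ (Fin n) × EuclideanSpace ℝ (Fin n))
    (hJ : ∀ w, J w = (-w.2, w.1)) :
    ∀ y w₁ w₂,
      F y w₁ w₂ - F y (J w₁) (J w₂) +
        Complex.I * (F y (J w₁) w₂ + F y w₁ (J w₂)) = 0 := by
  have hsymm : ∀ y u v, H y u v = H y v u := fun y u v ↦ by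
    rw [hH, hH]
    exact (hf.contDiffAt.isSymmSndFDerivAt (by simp)).eq u v
  have hneg : ∀ y u v, H y (-u) v = -H y u v := fun y u v ↦ by simp [hH]
  rintro y ⟨u, u'⟩ ⟨v, v'⟩
  simp only [hF, hJ, hneg]
  rw [hsymm y v u, hsymm y v u', hsymm y v' u, hsymm y v' u']
  push_cast
  ring
end
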